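/- arXiv:2110.05901 — 2 statements merged into one kernel-verified Lean document; each statement's English description precedes it below -/
import Mathlib

section
/- In a vertex-weighted bipartite instance with w(a) = c > 3 for all a ∈ A and w(b) = 1 for all b ∈ B, every popular matching admits a nice witness, i.e., a witness y with y_a ∈ {−c, 1−c, 2−c, −1, 0, 1} for all a ∈ A and y_b ∈ {−1, 0, 1, c−2, c−1, c} for all b ∈ B. -/
structure PMInstance (V : Type) [Fintype V] [DecidableEq V] where
  A : Finset V
  E : V → V → Prop
  Esymm : ∀ u v : V, E u v → E v u
  loopless : ∀ v : V, ¬ E v v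
  bipartite : ∀ u v : V, E u v → (u ∈ A ↔ v ∉ A)
  pref : V → V → V → Prop
  pref_irrefl : ∀ v u : V, ¬ pref v u u
  pref_trans : ∀ v u z t : V, pref v u z → pref v z t → pref v u t
  pref_asymm : ∀ v u z : V, pref v u z → ¬ pref v z u
  pref_total : ∀ v u z : V, E v u → E v z → u ≠ z → pref v u z ∨ pref v z u
  w : V → ℚ
  w_nonneg : ∀ v : V, 0 ≤ w v

structure Matching (V : Type) [Fintype V] [DecidableEq V] (E : V → V → Prop) where
  m : V → Option V
  msymm : ∀ u v : V, m u = some v ↔ m v = some u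
  valid : ∀ u v : V, m u = some v → E u v

attribute [local instance] Classical.propDecidable

variable {V : Type} [Fintype V] [DecidableEq V]

/-- Vertex `v` prefers matching `M` to matching `M'`. -/
def prefersVx (I : PMInstance V) (M M' : Matching V I.E) (v : V) : Prop :=
  (M'.m v = none ∧ M.m v ≠ none) ∨
    (∃ u u' : V, M.m v = some u ∧ M'.m v = some u' ∧ I.pref v u u')

/-- Total weight of the vertices preferring `M` to `M'`. -/
noncomputable def weightPref (I : PMInstance V) (M M' : Matching V I.E) : ℚ :=
  ∑ v : V, if prefersVx I M M' v then I.w v else 0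

/-- A matching is popular if it never loses a weighted head-to-head comparison. -/
def popular (I : PMInstance V) (M : Matching V I.E) : Prop :=
  ∀ M' : Matching V I.E, weightPref I M' M ≤ weightPref I M M'

/-- The vote of `u` for `v` against its partner in `M`. -/
noncomputable def vote (I : PMInstance V) (M : Matching V I.E) (u v : V) : ℚ :=
  if M.m u = some v then 0
  else if M.m u = none ∨ (∃ z : V, M.m u = some z ∧ I.pref u v z) then I.w u
  else - I.w u

/-- A witness of popularity of `M`. -/
def IsWitness (I : PMInstance V) (M : Matching V I.E) (y : V → ℚ) : Prop :=
  (∑ v : V, y v) = 0 ∧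
  (∀ u v : V, I.E u v → vote I M u v + vote I M v u ≤ y u + y v) ∧
  (∀ v : V, M.m v = none → 0 ≤ y v) ∧
  (∀ v : V, - I.w v ≤ y v)

/-- A nice witness: a witness with values from the six-element candidate sets. -/
def NiceWitness (I : PMInstance V) (M : Matching V I.E) (c : ℚ) (y : V → ℚ) : Prop :=
  IsWitness I M y ∧
    (∀ a ∈ I.A, y a ∈ ({-c, 1 - c, 2 - c, -1, 0, 1} : Set ℚ)) ∧
    (∀ b : V, b ∉ I.A → y b ∈ ({-1, 0, 1, c - 2, c - 1, c} : Set ℚ))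

/-- Egerváry's theorem, in the form: if no perfect matching along `R` has positive weight, then
there is an integral weighted cover of total value at most zero. -/
theorem exists_cover_of_perm_weight_nonpos {N : Type} [Fintype N] [DecidableEq N]
    (R : N → N → Prop) (W : N → N → ℤ)
    (h : ∀ σ : Equiv.Perm N, (∀ i, R i (σ i)) → ∑ i, W i (σ i) ≤ 0) :
    ∃ u v : N → ℤ, (∀ i j, R i j → W i j ≤ u i + v j) ∧ ∑ i, u i + ∑ i, v i ≤ 0 := by
  have key : ∀ n : ℕ, ∀ u v : N → ℤ, (∀ i j, R i j → W i j ≤ u i + v j) →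
      ∑ i, u i + ∑ i, v i ≤ n →
      ∃ u v : N → ℤ, (∀ i j, R i j → W i j ≤ u i + v j) ∧ ∑ i, u i + ∑ i, v i ≤ 0 := by
    intro n
    induction n with
    | zero => exact fun u v huv hs => ⟨u, v, huv, by simpa using hs⟩
    | succ n ih =>
      intro u v huv hs
      let t : N → Finset N := fun i => Finset.univ.filter fun j => R i j ∧ u i + v j = W i j
      by_cases hall : ∀ s : Finset N, s.card ≤ (s.biUnion t).card
      · obtain ⟨f, hf, hft⟩ := (Finset.all_card_le_biUnion_card_iff_exists_injective t).1 hall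
        simp only [t, Finset.mem_filter, Finset.mem_univ, true_and] at hft
        let σ : Equiv.Perm N := Equiv.ofBijective f (Finite.injective_iff_bijective.1 hf)
        refine ⟨u, v, huv, ?_⟩
        calc ∑ i, u i + ∑ i, v i = ∑ i, (u i + v (σ i)) := by
              rw [Finset.sum_add_distrib, Equiv.sum_comp σ v]
          _ = ∑ i, W i (σ i) := Finset.sum_congr rfl fun i _ => (hft i).2
          _ ≤ 0 := h σ fun i => (hft i).1
      · push Not at hall
        obtain ⟨s, hcard⟩ := hall
        refine ih (fun i => u i - if i ∈ s then 1 else 0)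
          (fun j => v j + if j ∈ s.biUnion t then 1 else 0) ?_ ?_
        · intro i j hij
          have h1 := huv i j hij
          by_cases hi : i ∈ s
          · by_cases hj : j ∈ s.biUnion t
            · simp only [hi, hj, if_true]; linarith
            · have h2 : u i + v j ≠ W i j := fun he =>
                hj (Finset.mem_biUnion.2 ⟨i, hi, by simp [t, hij, he]⟩)
              simp only [hi, hj, if_true, if_false]; omega
          · simp only [hi, if_false]; split_ifs <;> linarith
        · simp only [Finset.sum_sub_distrib, Finset.sum_add_distrib, Finset.sum_ite_mem,
            Finset.univ_inter, Finset.sum_const, nsmul_eq_mul, mul_one]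
          push_cast at hs
          omega
  let K : ℤ := ∑ i, ∑ j, |W i j|
  have hK : ∀ i j, W i j ≤ K := fun i j =>
    (le_abs_self _).trans <|
      (Finset.single_le_sum (f := fun j => |W i j|) (fun j _ => abs_nonneg _)
        (Finset.mem_univ j)).trans <|
      Finset.single_le_sum (f := fun i => ∑ j, |W i j|)
        (fun i _ => Finset.sum_nonneg fun j _ => abs_nonneg _) (Finset.mem_univ i)
  exact key (∑ _i : N, K + ∑ _i : N, 0).toNat (fun _ => K) (fun _ => 0)
    (fun i j _ => by simpa using hK i j) (Int.self_le_toNat _)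

/-- The vote of `u` for `v` against its partner in `M`, where voting for oneself means voting
for being unmatched. -/
noncomputable def voteSelf (I : PMInstance V) (M : Matching V I.E) (u v : V) : ℚ :=
  if v = u then (if M.m u = none then 0 else - I.w u) else vote I M u v

/-- The partner of `v` in `M`, or `v` itself if `v` is unmatched. -/
def Matching.partner {E : V → V → Prop} (M : Matching V E) (v : V) : V := (M.m v).getD v

theorem Matching.partner_of_eq_some {E : V → V → Prop} {M : Matching V E} {u v : V}
    (h : M.m u = some v) : M.partner u = v := by simp [partner, h]

theorem Matching.partner_of_eq_none {E : V → V → Prop} {M : Matching V E} {u : V}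
    (h : M.m u = none) : M.partner u = u := by simp [partner, h]

theorem Matching.partner_involutive {E : V → V → Prop} (M : Matching V E) :
    Function.Involutive M.partner := by
  intro v
  cases h : M.m v with
  | none => rw [partner_of_eq_none h, partner_of_eq_none h]
  | some u => rw [partner_of_eq_some h, partner_of_eq_some ((M.msymm v u).1 h)]

theorem Matching.sum_add_partner {E : V → V → Prop} (M : Matching V E) (y : V → ℚ) :
    ∑ v, (y v + y (M.partner v)) = 2 * ∑ v, y v := by
  have h : ∑ v, y (M.partner v) = ∑ v, y v := Equiv.sum_comp M.partner_involutive.toPerm y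
  rw [Finset.sum_add_distrib, h, two_mul]

theorem Matching.ne_of_eq_some {I : PMInstance V} (M : Matching V I.E) {u v : V}
    (h : M.m u = some v) : v ≠ u := by
  rintro rfl
  exact I.loopless _ (M.valid _ _ h)

theorem voteSelf_partner (I : PMInstance V) (M M' : Matching V I.E) (v : V) :
    voteSelf I M v (M'.partner v) =
      (if prefersVx I M' M v then I.w v else 0) - if prefersVx I M M' v then I.w v else 0 := by
  cases h' : M'.m v with
  | none =>
    rw [Matching.partner_of_eq_none h']
    cases h : M.m v <;> simp [voteSelf, prefersVx, h, h']
  | some x =>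
    rw [Matching.partner_of_eq_some h', voteSelf, if_neg (M'.ne_of_eq_some h'), vote]
    cases h : M.m v with
    | none => simp [prefersVx, h, h']
    | some z =>
      by_cases hxz : z = x
      · subst hxz
        simp [prefersVx, h, h', I.pref_irrefl]
      · rcases I.pref_total v x z (M'.valid _ _ h') (M.valid _ _ h) (Ne.symm hxz) with hp | hp
        · simp [prefersVx, h, h', hxz, hp, I.pref_asymm _ _ _ hp]
        · simp [prefersVx, h, h', hxz, hp, I.pref_asymm _ _ _ hp]

theorem popular.sum_voteSelf_nonpos {I : PMInstance V} {M : Matching V I.E} (hM : popular I M)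
    (M' : Matching V I.E) : ∑ v, voteSelf I M v (M'.partner v) ≤ 0 := by
  have h := hM M'
  simp only [weightPref] at h
  simp only [voteSelf_partner, Finset.sum_sub_distrib]
  linarith

/-- The matching pairing each non-fixed vertex of the side `S` with its image under `σ`. -/
noncomputable def matchingOfPerm (E : V → V → Prop) (S : V → Prop)
    (hE : ∀ u v, E u v → E v u) (hS : ∀ u v, E u v → (S u ↔ ¬ S v)) (σ : Equiv.Perm V)
    (hσ : ∀ v, σ v = v ∨ E v (σ v)) : Matching V E where
  m v := if σ v = v then none else some (if S v then σ v else σ.symm v)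
  msymm := by
    have aux : ∀ u v, (if σ u = u then none else some (if S u then σ u else σ.symm u)) = some v →
        (if σ v = v then none else some (if S v then σ v else σ.symm v)) = some u := by
      intro u v h
      by_cases hu : σ u = u
      · simp [hu] at h
      rw [if_neg hu, Option.some_inj] at h
      by_cases hSu : S u
      · rw [if_pos hSu] at h
        subst h
        have hS' := (hS _ _ ((hσ u).resolve_left hu)).1 hSu
        simp [hu, hS']
      · rw [if_neg hSu, Equiv.symm_apply_eq] at h
        subst h
        have hv : σ v ≠ v := fun hv => hu (by rw [hv, hv])
        have hS' : S v := (hS _ _ ((hσ v).resolve_left hv)).2 hSu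
        simp [hv, hS']
    exact fun u v => ⟨aux u v, aux v u⟩
  valid := by
    intro u v h
    by_cases hu : σ u = u
    · simp [hu] at h
    rw [if_neg hu, Option.some_inj] at h
    split_ifs at h with hSu
    · subst h
      exact (hσ u).resolve_left hu
    · rw [Equiv.symm_apply_eq] at h
      subst h
      exact hE _ _ ((hσ v).resolve_left fun hv => hu (by rw [hv, hv]))

theorem partner_matchingOfPerm (E : V → V → Prop) (S : V → Prop)
    (hE : ∀ u v, E u v → E v u) (hS : ∀ u v, E u v → (S u ↔ ¬ S v)) (σ : Equiv.Perm V)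
    (hσ : ∀ v, σ v = v ∨ E v (σ v)) (v : V) :
    (matchingOfPerm E S hE hS σ hσ).partner v = if S v then σ v else σ.symm v := by
  by_cases hv : σ v = v
  · have hv' : σ.symm v = v := by rw [Equiv.symm_apply_eq, hv]
    simp [Matching.partner, matchingOfPerm, hv, hv']
  · simp [Matching.partner, matchingOfPerm, hv]

theorem popular.sum_perm_voteSelf_nonpos {I : PMInstance V} {M : Matching V I.E}
    (hM : popular I M) (σ : Equiv.Perm V) (hσ : ∀ v, σ v = v ∨ I.E v (σ v)) :
    ∑ v, (voteSelf I M v (σ v) + voteSelf I M (σ v) v) ≤ 0 := by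
  have hS : ∀ u v, I.E u v → ((u ∈ I.A) ↔ ¬ (v ∈ I.A)) := I.bipartite
  have hS' : ∀ u v, I.E u v → ((u ∉ I.A) ↔ ¬ (v ∉ I.A)) := fun u v h => not_congr (hS u v h)
  have h1 := hM.sum_voteSelf_nonpos (matchingOfPerm I.E (· ∈ I.A) I.Esymm hS σ hσ)
  have h2 := hM.sum_voteSelf_nonpos (matchingOfPerm I.E (· ∉ I.A) I.Esymm hS' σ hσ)
  have h3 : ∑ v, voteSelf I M (σ v) v = ∑ v, voteSelf I M v (σ.symm v) := by
    rw [← Equiv.sum_comp σ (fun v => voteSelf I M v (σ.symm v))]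
    simp
  have h4 := add_nonpos h1 h2
  rw [← Finset.sum_add_distrib] at h4
  rw [Finset.sum_add_distrib, h3, ← Finset.sum_add_distrib]
  refine le_of_eq_of_le (Finset.sum_congr rfl fun v _ => ?_) h4
  simp only [partner_matchingOfPerm]
  by_cases hv : v ∈ I.A <;> simp [hv, add_comm]

theorem exists_int_mul_voteSelf (I : PMInstance V) (M : Matching V I.E) (d : ℚ)
    (hd : ∀ v, ∃ z : ℤ, d * I.w v = z) (u v : V) : ∃ z : ℤ, d * voteSelf I M u v = z := by
  obtain ⟨z, hz⟩ := hd u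
  unfold voteSelf vote
  split_ifs
  exacts [⟨0, by simp⟩, ⟨-z, by simp [hz]⟩, ⟨0, by simp⟩, ⟨z, hz⟩, ⟨-z, by simp [hz]⟩]

theorem PMInstance.exists_common_denominator (I : PMInstance V) :
    ∃ d : ℚ, 0 < d ∧ ∀ v, ∃ z : ℤ, d * I.w v = z := by
  refine ⟨∏ v, ((I.w v).den : ℚ), Finset.prod_pos fun v _ => by exact_mod_cast (I.w v).den_pos,
    fun v => ⟨(∏ x ∈ Finset.univ.erase v, ((I.w x).den : ℤ)) * (I.w v).num, ?_⟩⟩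
  rw [← Finset.prod_erase_mul _ _ (Finset.mem_univ v), mul_assoc, Rat.den_mul_eq_num]
  push_cast
  rfl

theorem popular.exists_fractional_cover {I : PMInstance V} {M : Matching V I.E}
    (hM : popular I M) : ∃ y : V → ℚ, ∑ v, y v ≤ 0 ∧
      (∀ u v, I.E u v → vote I M u v + vote I M v u ≤ y u + y v) ∧
      (∀ v, voteSelf I M v v ≤ y v) := by
  obtain ⟨d, hd, hw⟩ := I.exists_common_denominator
  choose W hW using exists_int_mul_voteSelf I M d hw
  obtain ⟨p, q, hpq, hsum⟩ := exists_cover_of_perm_weight_nonpos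
    (fun i j => j = i ∨ I.E i j) (fun i j => W i j + W j i) (by
      intro σ hσ
      have h := mul_nonpos_of_nonneg_of_nonpos hd.le (hM.sum_perm_voteSelf_nonpos σ hσ)
      simp only [Finset.mul_sum, mul_add, hW] at h
      exact_mod_cast h)
  have hpq' : ∀ i j, (j = i ∨ I.E i j) →
      d * voteSelf I M i j + d * voteSelf I M j i ≤ p i + q j := fun i j hij => by
    rw [hW, hW]
    exact_mod_cast hpq i j hij
  refine ⟨fun v => (p v + q v) / (2 * d), ?_, fun u v huv => ?_, fun v => ?_⟩
  · rw [← Finset.sum_div, Finset.sum_add_distrib]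
    exact div_nonpos_of_nonpos_of_nonneg (by exact_mod_cast hsum) (by positivity)
  · have huv' : v ≠ u := by
      rintro rfl
      exact I.loopless _ huv
    have h1 := hpq' u v (Or.inr huv)
    have h2 := hpq' v u (Or.inr (I.Esymm _ _ huv))
    simp only [voteSelf, huv', huv'.symm, if_false] at h1 h2
    rw [← add_div, le_div_iff₀ (by positivity)]
    linarith
  · have h := hpq' v v (Or.inl rfl)
    rw [le_div_iff₀ (by positivity)]
    linarith

theorem add_partner_eq_zero {I : PMInstance V} {M : Matching V I.E} {y : V → ℚ}
    (hsum : ∑ v, y v ≤ 0)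
    (hedge : ∀ u v, I.E u v → vote I M u v + vote I M v u ≤ y u + y v)
    (hself : ∀ v, voteSelf I M v v ≤ y v) (v : V) : y v + y (M.partner v) = 0 := by
  have hnonneg : ∀ v ∈ Finset.univ, 0 ≤ y v + y (M.partner v) := by
    intro v _
    cases h : M.m v with
    | none =>
      have := hself v
      simp only [voteSelf, h, if_true] at this
      rw [Matching.partner_of_eq_none h]
      linarith
    | some u =>
      have := hedge v u (M.valid _ _ h)
      simp only [vote, h, (M.msymm v u).1 h, if_true] at this
      rw [Matching.partner_of_eq_some h]
      linarith
  have h0 : ∑ v, (y v + y (M.partner v)) = 0 :=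
    le_antisymm (by rw [M.sum_add_partner]; linarith) (Finset.sum_nonneg hnonneg)
  exact (Finset.sum_eq_zero_iff_of_nonneg hnonneg).1 h0 v (Finset.mem_univ v)

/-- Every popular matching admits a witness, and its values cancel along the matching. -/
theorem popular.exists_isWitness {I : PMInstance V} {M : Matching V I.E} (hM : popular I M) :
    ∃ y : V → ℚ, IsWitness I M y ∧ ∀ v, y v + y (M.partner v) = 0 := by
  obtain ⟨y, hsum, hedge, hself⟩ := hM.exists_fractional_cover
  have hp := add_partner_eq_zero hsum hedge hself
  refine ⟨y, ⟨?_, hedge, fun v hv => ?_, fun v => ?_⟩, hp⟩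
  · have h := M.sum_add_partner y
    simp only [hp, Finset.sum_const_zero] at h
    linarith
  · have h := hself v
    simpa only [voteSelf, hv, if_true] using h
  · have h := hself v
    have h0 := I.w_nonneg v
    simp only [voteSelf, if_true] at h
    split_ifs at h <;> linarith

/-- Rounding down to the nearest of the values `-1, 0, 1, c - 2, c - 1, c`. -/
def roundNice (c p : ℚ) : ℚ :=
  if p < 0 then -1 else if p < 1 then 0 else if p < c - 2 then 1
  else if p < c - 1 then c - 2 else if p < c then c - 1 else c

theorem roundNice_mem (c p : ℚ) : roundNice c p ∈ ({-1, 0, 1, c - 2, c - 1, c} : Set ℚ) := by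
  unfold roundNice
  split_ifs <;> simp

theorem neg_roundNice_mem (c p : ℚ) :
    -roundNice c p ∈ ({-c, 1 - c, 2 - c, -1, 0, 1} : Set ℚ) := by
  unfold roundNice
  split_ifs <;> simp

theorem roundNice_zero (c : ℚ) : roundNice c 0 = 0 := by simp [roundNice]

theorem neg_one_le_roundNice {c : ℚ} (hc : 3 < c) (p : ℚ) : -1 ≤ roundNice c p := by
  unfold roundNice
  split_ifs <;> linarith

theorem roundNice_le {c : ℚ} (hc : 3 < c) (p : ℚ) : roundNice c p ≤ c := by
  unfold roundNice
  split_ifs <;> linarith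

theorem le_roundNice_sub {c p q s t : ℚ} (hc : 3 < c) (hp : -1 ≤ p) (hp' : p ≤ c)
    (hq : q ≤ c) (hs : s = c ∨ s = -c) (ht : t = 1 ∨ t = -1)
    (h : s + t ≤ q - p) : s + t ≤ roundNice c q - roundNice c p := by
  unfold roundNice
  rcases hs with rfl | rfl <;> rcases ht with rfl | rfl <;> split_ifs <;> linarith

theorem vote_eq_or_eq_neg (I : PMInstance V) (M : Matching V I.E) {u v : V}
    (h : M.m u ≠ some v) : vote I M u v = I.w u ∨ vote I M u v = -I.w u := by
  rw [vote, if_neg h]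
  split_ifs <;> simp

/-- With `w(a) = c > 3` on `A` and `w(b) = 1` on `B`, every popular matching
admits a nice witness. -/
theorem exists_nice_witness (I : PMInstance V) (c : ℚ) (hc : 3 < c)
    (hA : ∀ a ∈ I.A, I.w a = c) (hB : ∀ b : V, b ∉ I.A → I.w b = 1)
    (M : Matching V I.E) (hM : popular I M) :
    ∃ y : V → ℚ, NiceWitness I M c y := by
  obtain ⟨y, ⟨-, hedge, -, hlow⟩, hp⟩ := hM.exists_isWitness
  let y' : V → ℚ := fun v => if v ∈ I.A then -roundNice c (-y v) else roundNice c (y v)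
  have hyA : ∀ v ∈ I.A, y' v = -roundNice c (-y v) := fun v hv => if_pos hv
  have hyB : ∀ v ∉ I.A, y' v = roundNice c (y v) := fun v hv => if_neg hv
  have hnone : ∀ v, M.m v = none → y v = 0 := fun v hv => by
    have h := hp v
    rw [Matching.partner_of_eq_none hv] at h
    linarith
  have hnone' : ∀ v, M.m v = none → y' v = 0 := fun v hv => by
    simp [y', hnone v hv, roundNice_zero]
  have hsome' : ∀ u v, M.m u = some v → y' u + y' v = 0 := fun u v huv => by
    have h := hp u
    rw [Matching.partner_of_eq_some huv] at h
    have hb := I.bipartite u v (M.valid _ _ huv)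
    by_cases hu : u ∈ I.A
    · rw [hyA u hu, hyB v (hb.1 hu), neg_eq_of_add_eq_zero_right h, neg_add_cancel]
    · rw [hyB u hu, hyA v (by tauto), neg_eq_of_add_eq_zero_left h, add_neg_cancel]
  have hp' : ∀ v, y' v + y' (M.partner v) = 0 := fun v => by
    cases h : M.m v with
    | none => rw [Matching.partner_of_eq_none h, hnone' v h, add_zero]
    | some u => rw [Matching.partner_of_eq_some h, hsome' v u h]
  have hupA : ∀ a ∈ I.A, y a ≤ 1 := fun a ha => by
    cases h : M.m a with
    | none => rw [hnone a h]; norm_num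
    | some b =>
      have h1 := hp a
      rw [Matching.partner_of_eq_some h] at h1
      have h2 := hlow b
      rw [hB b ((I.bipartite a b (M.valid _ _ h)).1 ha)] at h2
      linarith
  have hupB : ∀ b ∉ I.A, y b ≤ c := fun b hb => by
    cases h : M.m b with
    | none => rw [hnone b h]; linarith
    | some a =>
      have h1 := hp b
      rw [Matching.partner_of_eq_some h] at h1
      have h2 := hlow a
      rw [hA a ((I.bipartite a b (I.Esymm _ _ (M.valid _ _ h))).2 hb)] at h2
      linarith
  have hedge' : ∀ a b, I.E a b → a ∈ I.A → vote I M a b + vote I M b a ≤ y' a + y' b := by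
    intro a b hab ha
    have hb : b ∉ I.A := (I.bipartite a b hab).1 ha
    by_cases hm : M.m a = some b
    · rw [hsome' a b hm]
      simp [vote, hm, (M.msymm a b).1 hm]
    · have hla := hlow a
      have hva := vote_eq_or_eq_neg I M hm
      have hvb := vote_eq_or_eq_neg I M (mt (M.msymm a b).2 hm)
      rw [hA a ha] at hla hva
      rw [hB b hb] at hvb
      have hua := hupA a ha
      have h := le_roundNice_sub (p := -y a) hc (by linarith) (by linarith) (hupB b hb)
        hva hvb (by linarith [hedge a b hab])
      rw [hyA a ha, hyB b hb]
      linarith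
  refine ⟨y', ⟨?_, fun u v huv => ?_, fun v hv => (hnone' v hv).ge, fun v => ?_⟩,
    fun a ha => ?_, fun b hb => ?_⟩
  · have h := M.sum_add_partner y'
    simp only [hp', Finset.sum_const_zero] at h
    linarith
  · by_cases hu : u ∈ I.A
    · exact hedge' u v huv hu
    · have hb := I.bipartite u v huv
      rw [add_comm (vote I M u v), add_comm (y' u)]
      exact hedge' v u (I.Esymm _ _ huv) (by tauto)
  · by_cases hv : v ∈ I.A
    · rw [hyA v hv, hA v hv]
      exact neg_le_neg (roundNice_le hc _)
    · rw [hyB v hv, hB v hv]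
      exact neg_one_le_roundNice hc _
  · rw [hyA a ha]
    exact neg_roundNice_mem c _
  · rw [hyB b hb]
    exact roundNice_mem c _
end

section
/- Let P be a path component ⟨a1, b1, a2, b2, ..., ak, bk⟩ (with a1 ∈ A unmatched by the smaller popular matching) of the pruned popular-edge graph in an instance with w(a) = c > 3 for all a ∈ A and w(b) = 1 for all b ∈ B, and let M1 be the perfect popular matching on P and M2 the popular matching leaving a vertex unmatched. Then M1 has a unique nice witness y^odd and M2 has a unique nice witness y^even, given by y^odd_{a_{2i−1}} = −c, y^odd_{a_{2i}} = 1, y^odd_{b_{2i−1}} = c, y^odd_{b_{2i}} = −1 and y^even_{a_{2i−1}} = 0, y^even_{a_{2i}} = 1−c, y^even_{b_{2i−1}} = c−1, y^even_{b_{2i}} = 0. -/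
attribute [local instance] Classical.propDecidable

variable {V : Type} [Fintype V] [DecidableEq V]

/-- Under the option-valued partners `o` and `o'`, vertex `v` prefers `o` to `o'`. -/
def PrefersPartner (I : PMInstance V) (v : V) (o o' : Option V) : Prop :=
  (o' = none ∧ o ≠ none) ∨ (∃ u u' : V, o = some u ∧ o' = some u' ∧ I.pref v u u')

/-- The weighted vote of `v` for replacing the partner `o` by `o'`. -/
noncomputable def gain (I : PMInstance V) (v : V) (o o' : Option V) : ℚ :=
  (if PrefersPartner I v o' o then I.w v else 0) - (if PrefersPartner I v o o' then I.w v else 0)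

lemma gain_self (I : PMInstance V) (v : V) (o : Option V) : gain I v o o = 0 := by
  simp [gain]

lemma gain_swap (I : PMInstance V) (v : V) (o o' : Option V) :
    gain I v o' o = - gain I v o o' := by
  simp [gain]

lemma gain_none_some (I : PMInstance V) (v u : V) : gain I v none (some u) = I.w v := by
  simp [gain, PrefersPartner]

lemma gain_some_none (I : PMInstance V) (v u : V) : gain I v (some u) none = - I.w v := by
  simp [gain, PrefersPartner]

lemma gain_some_some_of_pref (I : PMInstance V) {v u z : V} (h : I.pref v z u) :
    gain I v (some u) (some z) = I.w v := by
  have := I.pref_asymm _ _ _ h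
  simp [gain, PrefersPartner, h, this]

lemma gain_some_some_or (I : PMInstance V) {v u z : V} (hu : I.E v u) (hz : I.E v z)
    (h : u ≠ z) :
    gain I v (some u) (some z) = I.w v ∨ gain I v (some u) (some z) = - I.w v := by
  rcases I.pref_total v u z hu hz h with h | h
  · right
    rw [gain_swap, gain_some_some_of_pref I h]
  · exact .inl (gain_some_some_of_pref I h)

lemma vote_eq_gain (I : PMInstance V) (M : Matching V I.E) {u v : V} (h : I.E u v) :
    vote I M u v = gain I u (M.m u) (some v) := by
  unfold vote
  rcases hm : M.m u with _ | z
  · simp [gain_none_some]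
  · by_cases hz : z = v
    · simp [hz, gain_self]
    · rcases I.pref_total u z v (M.valid _ _ hm) h hz with hp | hp
      · rw [gain_swap, gain_some_some_of_pref I hp]
        simp [hz, I.pref_asymm _ _ _ hp]
      · rw [gain_some_some_of_pref I hp]
        simp [hz, hp]

lemma popular.sum_gain_nonpos {I : PMInstance V} {M : Matching V I.E} (h : popular I M)
    (N : Matching V I.E) : ∑ v, gain I v (M.m v) (N.m v) ≤ 0 := by
  have := h N
  unfold weightPref at this
  simp only [gain, Finset.sum_sub_distrib]
  exact sub_nonpos.mpr this

/-- Use `M` on a set `S` closed under `M`, and outside of `S` keep the edges of `N`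
avoiding `S`. -/
noncomputable def Matching.splice {E : V → V → Prop} (M N : Matching V E) (S : V → Prop)
    (hS : ∀ u v, M.m u = some v → S u → S v) : Matching V E where
  m v := if S v then M.m v else (N.m v).filter (fun u => ¬ S u)
  msymm u v := by
    have key : ∀ u v, (if S u then M.m u else (N.m u).filter (fun u => ¬ S u)) = some v →
        (if S v then M.m v else (N.m v).filter (fun u => ¬ S u)) = some u := by
      intro u v h
      by_cases hu : S u
      · rw [if_pos hu] at h
        rw [if_pos (hS u v h hu)]
        exact (M.msymm _ _).1 h
      · rw [if_neg hu, Option.filter_eq_some_iff] at h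
        have hv : ¬ S v := by simpa using h.2
        rw [if_neg hv, Option.filter_eq_some_iff]
        exact ⟨(N.msymm _ _).1 h.1, by simpa using hu⟩
    exact ⟨key u v, key v u⟩
  valid u v h := by
    by_cases hu : S u
    · rw [if_pos hu] at h
      exact M.valid _ _ h
    · rw [if_neg hu, Option.filter_eq_some_iff] at h
      exact N.valid _ _ h.1

/-- The path `a 0, b 0, a 1, b 1, …, a (k - 1), b (k - 1)` with its perfect matching `M₁` and
the matching `M₂` missing the two end vertices. -/
structure IsPathComponent (I : PMInstance V) (c : ℚ) (k : ℕ) (a b : ℕ → V)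
    (M₁ M₂ : Matching V I.E) : Prop where
  pos : 0 < k
  two_lt : 2 < c
  w_a : ∀ i < k, I.w (a i) = c
  w_b : ∀ i < k, I.w (b i) = 1
  a_inj : ∀ i < k, ∀ j < k, a i = a j → i = j
  b_inj : ∀ i < k, ∀ j < k, b i = b j → i = j
  a_ne_b : ∀ i < k, ∀ j < k, a i ≠ b j
  sum_eq : ∀ F : V → ℚ, ∑ v, F v = ∑ i ∈ Finset.range k, (F (a i) + F (b i))
  M₁_a : ∀ i < k, M₁.m (a i) = some (b i)
  M₂_b : ∀ i, i + 1 < k → M₂.m (b i) = some (a (i + 1))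
  M₂_a_zero : M₂.m (a 0) = none
  M₂_b_last : ∀ i, i + 1 = k → M₂.m (b i) = none
  popular₁ : popular I M₁
  popular₂ : popular I M₂

namespace IsPathComponent

variable {I : PMInstance V} {c : ℚ} {k : ℕ} {a b : ℕ → V} {M₁ M₂ : Matching V I.E}

lemma M₁_b (h : IsPathComponent I c k a b M₁ M₂) {i : ℕ} (hi : i < k) :
    M₁.m (b i) = some (a i) :=
  (M₁.msymm _ _).1 (h.M₁_a i hi)

lemma M₂_a (h : IsPathComponent I c k a b M₁ M₂) {i : ℕ} (hi : i + 1 < k) :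
    M₂.m (a (i + 1)) = some (b i) :=
  (M₂.msymm _ _).1 (h.M₂_b i hi)

/-- The vertices of the path whose index satisfies `P`. -/
def indexSet (k : ℕ) (a b : ℕ → V) (P : ℕ → Prop) (v : V) : Prop :=
  ∃ i < k, P i ∧ (v = a i ∨ v = b i)

lemma indexSet_a (h : IsPathComponent I c k a b M₁ M₂) (P : ℕ → Prop) {i : ℕ} (hi : i < k) :
    indexSet k a b P (a i) ↔ P i := by
  constructor
  · rintro ⟨j, hj, hP, e | e⟩
    · rwa [h.a_inj i hi j hj e]
    · exact absurd e (h.a_ne_b i hi j hj)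
  · exact fun hP => ⟨i, hi, hP, .inl rfl⟩

lemma indexSet_b (h : IsPathComponent I c k a b M₁ M₂) (P : ℕ → Prop) {i : ℕ} (hi : i < k) :
    indexSet k a b P (b i) ↔ P i := by
  constructor
  · rintro ⟨j, hj, hP, e | e⟩
    · exact absurd e.symm (h.a_ne_b j hj i hi)
    · rwa [h.b_inj i hi j hj e]
  · exact fun hP => ⟨i, hi, hP, .inr rfl⟩

lemma indexSet_closed (h : IsPathComponent I c k a b M₁ M₂) (P : ℕ → Prop) (u v : V)
    (huv : M₁.m u = some v) (hu : indexSet k a b P u) : indexSet k a b P v := by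
  obtain ⟨i, hi, hP, rfl | rfl⟩ := hu
  · rw [h.M₁_a i hi] at huv
    exact ⟨i, hi, hP, .inr (Option.some.inj huv).symm⟩
  · rw [h.M₁_b hi] at huv
    exact ⟨i, hi, hP, .inl (Option.some.inj huv).symm⟩

/-- The matching following `M₁` on the indices satisfying `P` and `M₂` elsewhere. -/
noncomputable def hybrid (h : IsPathComponent I c k a b M₁ M₂) (P : ℕ → Prop) :
    Matching V I.E :=
  M₁.splice M₂ (indexSet k a b P) (h.indexSet_closed P)

lemma hybrid_a_of (h : IsPathComponent I c k a b M₁ M₂) {P : ℕ → Prop} {i : ℕ} (hi : i < k)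
    (hP : P i) : (h.hybrid P).m (a i) = M₁.m (a i) :=
  if_pos ((h.indexSet_a P hi).2 hP)

lemma hybrid_b_of (h : IsPathComponent I c k a b M₁ M₂) {P : ℕ → Prop} {i : ℕ} (hi : i < k)
    (hP : P i) : (h.hybrid P).m (b i) = M₁.m (b i) :=
  if_pos ((h.indexSet_b P hi).2 hP)

lemma hybrid_a_zero (h : IsPathComponent I c k a b M₁ M₂) {P : ℕ → Prop} (hP : ¬ P 0) :
    (h.hybrid P).m (a 0) = M₂.m (a 0) := by
  refine (if_neg (mt (h.indexSet_a P h.pos).1 hP)).trans ?_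
  simp [h.M₂_a_zero]

lemma hybrid_a_succ (h : IsPathComponent I c k a b M₁ M₂) {P : ℕ → Prop} {i : ℕ}
    (hi : i + 1 < k) (hP : ¬ P (i + 1)) :
    (h.hybrid P).m (a (i + 1)) = if P i then none else M₂.m (a (i + 1)) := by
  refine (if_neg (mt (h.indexSet_a P hi).1 hP)).trans ?_
  have := h.indexSet_b P (i := i) (by omega)
  by_cases hp : P i <;> simp [h.M₂_a hi, Option.filter, this, hp]

lemma hybrid_b (h : IsPathComponent I c k a b M₁ M₂) {P : ℕ → Prop} {i : ℕ}
    (hi : i + 1 < k) (hP : ¬ P i) :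
    (h.hybrid P).m (b i) = if P (i + 1) then none else M₂.m (b i) := by
  refine (if_neg (mt (h.indexSet_b P (by omega)).1 hP)).trans ?_
  have := h.indexSet_a P hi
  by_cases hp : P (i + 1) <;> simp [h.M₂_b i hi, Option.filter, this, hp]

lemma hybrid_b_last (h : IsPathComponent I c k a b M₁ M₂) {P : ℕ → Prop} {i : ℕ}
    (hi : i + 1 = k) (hP : ¬ P i) : (h.hybrid P).m (b i) = M₂.m (b i) := by
  refine (if_neg (mt (h.indexSet_b P (by omega)).1 hP)).trans ?_
  simp [h.M₂_b_last i hi]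

variable (I a M₁ M₂) in
/-- The vote of `a i` for `M₂` against `M₁`. -/
noncomputable def voteA (i : ℕ) : ℚ := gain I (a i) (M₁.m (a i)) (M₂.m (a i))

variable (I b M₁ M₂) in
/-- The vote of `b i` for `M₂` against `M₁`. -/
noncomputable def voteB (i : ℕ) : ℚ := gain I (b i) (M₁.m (b i)) (M₂.m (b i))

lemma voteA_zero (h : IsPathComponent I c k a b M₁ M₂) : voteA I a M₁ M₂ 0 = -c := by
  rw [voteA, h.M₂_a_zero, h.M₁_a 0 h.pos, gain_some_none, h.w_a 0 h.pos]

lemma voteB_last (h : IsPathComponent I c k a b M₁ M₂) {i : ℕ} (hi : i + 1 = k) :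
    voteB I b M₁ M₂ i = -1 := by
  rw [voteB, h.M₂_b_last i hi, h.M₁_b (by omega), gain_some_none, h.w_b i (by omega)]

lemma voteA_or (h : IsPathComponent I c k a b M₁ M₂) {i : ℕ} (hi : i < k) :
    voteA I a M₁ M₂ i = c ∨ voteA I a M₁ M₂ i = -c := by
  obtain _ | i := i
  · exact .inr h.voteA_zero
  · have hne : b (i + 1) ≠ b i := fun e => by
      have := h.b_inj _ hi _ (by omega) e
      omega
    have := gain_some_some_or I (M₁.valid _ _ (h.M₁_a _ hi)) (M₂.valid _ _ (h.M₂_a hi)) hne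
    rwa [h.w_a _ hi, ← h.M₁_a _ hi, ← h.M₂_a hi] at this

lemma voteB_or (h : IsPathComponent I c k a b M₁ M₂) {i : ℕ} (hi : i < k) :
    voteB I b M₁ M₂ i = 1 ∨ voteB I b M₁ M₂ i = -1 := by
  by_cases hk : i + 1 < k
  · have hne : a i ≠ a (i + 1) := fun e => by
      have := h.a_inj _ hi _ hk e
      omega
    have := gain_some_some_or I (M₁.valid _ _ (h.M₁_b hi)) (M₂.valid _ _ (h.M₂_b i hk)) hne
    rwa [h.w_b _ hi, ← h.M₁_b hi, ← h.M₂_b i hk] at this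
  · exact .inr (h.voteB_last (by omega))

lemma sum_range_of_eq_zero {f : ℕ → ℚ} {j k : ℕ} (hj : j ≤ k)
    (hf : ∀ i < k, j ≤ i → f i = 0) :
    ∑ i ∈ Finset.range k, f i = ∑ i ∈ Finset.range j, f i := by
  refine (Finset.sum_subset (by simpa using hj) fun i hi hi' => ?_).symm
  exact hf i (by simpa using hi) (by simpa using hi')

lemma prefix_sum_le_one (h : IsPathComponent I c k a b M₁ M₂) {j : ℕ} (hj : j < k) :
    ∑ i ∈ Finset.range j, (voteA I a M₁ M₂ i + voteB I b M₁ M₂ i) + voteA I a M₁ M₂ j ≤ 1 := by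
  have key := h.popular₁.sum_gain_nonpos (h.hybrid (fun i => j < i))
  have hA : ∀ i ≤ j, (h.hybrid (fun i => j < i)).m (a i) = M₂.m (a i) := by
    intro i hi
    obtain _ | i := i
    · exact h.hybrid_a_zero (by omega)
    · rw [h.hybrid_a_succ (by omega) (by omega), if_neg (by omega)]
  rw [h.sum_eq, sum_range_of_eq_zero (j := j + 1) (by omega), Finset.sum_range_succ,
    Finset.sum_congr rfl (g := fun i => voteA I a M₁ M₂ i + voteB I b M₁ M₂ i), hA j le_rfl] at key
  · have hb : gain I (b j) (M₁.m (b j)) ((h.hybrid (fun i => j < i)).m (b j)) = -1 := by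
      have : (h.hybrid (fun i => j < i)).m (b j) = none := by
        by_cases hk : j + 1 < k
        · rw [h.hybrid_b hk (by omega), if_pos (by omega)]
        · rw [h.hybrid_b_last (by omega) (by omega), h.M₂_b_last _ (by omega)]
      rw [this, h.M₁_b hj, gain_some_none, h.w_b j hj]
    rw [hb] at key
    simp only [voteA, voteB] at *
    linarith
  · intro i hi
    have hi : i < j := by simpa using hi
    rw [hA i hi.le, h.hybrid_b (by omega) (by omega), if_neg (by omega)]
    rfl
  · intro i hi hji
    rw [h.hybrid_a_of hi (by omega), h.hybrid_b_of hi (by omega), gain_self, gain_self, add_zero]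

lemma neg_le_prefix_sum (h : IsPathComponent I c k a b M₁ M₂) {j : ℕ} (hj : j + 1 < k) :
    -c ≤ ∑ i ∈ Finset.range (j + 1), (voteA I a M₁ M₂ i + voteB I b M₁ M₂ i) := by
  have key := h.popular₂.sum_gain_nonpos (h.hybrid (fun i => i ≤ j))
  have hB : ∀ i < k, j < i → (h.hybrid (fun i => i ≤ j)).m (b i) = M₂.m (b i) := by
    intro i hi hji
    by_cases hk : i + 1 < k
    · rw [h.hybrid_b hk (by omega), if_neg (by omega)]
    · exact h.hybrid_b_last (by omega) (by omega)
  rw [h.sum_eq, sum_range_of_eq_zero (j := j + 2) (by omega), Finset.sum_range_succ,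
    Finset.sum_congr rfl (g := fun i => -(voteA I a M₁ M₂ i + voteB I b M₁ M₂ i)),
    hB _ hj (by omega), gain_self, h.hybrid_a_succ hj (by omega), if_pos le_rfl, h.M₂_a hj,
    gain_some_none, h.w_a _ hj, Finset.sum_neg_distrib] at key
  · linarith
  · intro i hi
    have hi : i < j + 1 := by simpa using hi
    rw [h.hybrid_a_of (by omega) (by omega), h.hybrid_b_of (by omega) (by omega), gain_swap,
      gain_swap I (b i), neg_add]
    rfl
  · intro i hi hji
    obtain _ | i := i
    · omega
    rw [hB _ hi (by omega), h.hybrid_a_succ hi (by omega), if_neg (by omega), gain_self,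
      gain_self, add_zero]

lemma prefix_sum_le_one_add_sum (h : IsPathComponent I c k a b M₁ M₂) {j : ℕ} (hj : j + 1 < k) :
    ∑ i ∈ Finset.range (j + 1), (voteA I a M₁ M₂ i + voteB I b M₁ M₂ i) ≤
      1 + ∑ i ∈ Finset.range k, (voteA I a M₁ M₂ i + voteB I b M₁ M₂ i) := by
  have key := h.popular₂.sum_gain_nonpos (h.hybrid (fun i => j < i))
  have hA : ∀ i ≤ j, (h.hybrid (fun i => j < i)).m (a i) = M₂.m (a i) := by
    intro i hi
    obtain _ | i := i
    · exact h.hybrid_a_zero (by omega)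
    · rw [h.hybrid_a_succ (by omega) (by omega), if_neg (by omega)]
  have hs := sum_range_of_eq_zero (j := j + 1) (k := k)
    (f := fun i => gain I (a i) (M₂.m (a i)) ((h.hybrid (fun i => j < i)).m (a i)) +
      gain I (b i) (M₂.m (b i)) ((h.hybrid (fun i => j < i)).m (b i)) +
      (voteA I a M₁ M₂ i + voteB I b M₁ M₂ i)) (by omega) (by
    intro i hi hji
    rw [h.hybrid_a_of hi (by omega), h.hybrid_b_of hi (by omega), gain_swap, gain_swap I (b i)]
    simp only [voteA, voteB]
    ring)
  have hpre : ∑ i ∈ Finset.range (j + 1),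
      (gain I (a i) (M₂.m (a i)) ((h.hybrid (fun i => j < i)).m (a i)) +
        gain I (b i) (M₂.m (b i)) ((h.hybrid (fun i => j < i)).m (b i))) = -1 := by
    rw [Finset.sum_range_succ, Finset.sum_eq_zero, hA j le_rfl, gain_self,
      h.hybrid_b hj (by omega), if_pos (by omega), h.M₂_b j hj, gain_some_none,
      h.w_b j (by omega)]
    · ring
    · intro i hi
      have hi : i < j := by simpa using hi
      rw [hA i hi.le, h.hybrid_b (by omega) (by omega), if_neg (by omega), gain_self, gain_self,
        add_zero]
  rw [h.sum_eq] at key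
  rw [Finset.sum_add_distrib, Finset.sum_add_distrib (s := Finset.range (j + 1)), hpre] at hs
  linarith

lemma sum_nonneg (h : IsPathComponent I c k a b M₁ M₂) :
    0 ≤ ∑ i ∈ Finset.range k, (voteA I a M₁ M₂ i + voteB I b M₁ M₂ i) := by
  have key := h.popular₂.sum_gain_nonpos M₁
  rw [h.sum_eq, Finset.sum_congr rfl
    (g := fun i => -(voteA I a M₁ M₂ i + voteB I b M₁ M₂ i)), Finset.sum_neg_distrib] at key
  · linarith
  · intro i _
    rw [gain_swap, gain_swap I (b i), neg_add]
    rfl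

lemma sum_eq_zero (h : IsPathComponent I c k a b M₁ M₂) :
    ∑ i ∈ Finset.range k, (voteA I a M₁ M₂ i + voteB I b M₁ M₂ i) = 0 := by
  refine le_antisymm ?_ h.sum_nonneg
  obtain ⟨n, rfl⟩ : ∃ n, k = n + 1 := ⟨k - 1, by have := h.pos; omega⟩
  have := h.prefix_sum_le_one (Nat.lt_succ_self n)
  rw [Finset.sum_range_succ, h.voteB_last (i := n) rfl]
  linarith

lemma prefix_sum_bounds (h : IsPathComponent I c k a b M₁ M₂) {j : ℕ} (hj : j < k) :
    -c ≤ ∑ i ∈ Finset.range (j + 1), (voteA I a M₁ M₂ i + voteB I b M₁ M₂ i) ∧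
      ∑ i ∈ Finset.range (j + 1), (voteA I a M₁ M₂ i + voteB I b M₁ M₂ i) ≤ 1 := by
  have h0 := h.sum_eq_zero
  have hc := h.two_lt
  by_cases hk : j + 1 < k
  · have := h.neg_le_prefix_sum hk
    have := h.prefix_sum_le_one_add_sum hk
    constructor <;> linarith
  · obtain rfl : j + 1 = k := by omega
    rw [h0]
    constructor <;> linarith

lemma votes_and_sum (h : IsPathComponent I c k a b M₁ M₂) (j : ℕ) (hj : j < k) :
    voteA I a M₁ M₂ j = (if Even j then -c else c) ∧
      voteB I b M₁ M₂ j = (if Even j then 1 else -1) ∧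
      ∑ i ∈ Finset.range (j + 1), (voteA I a M₁ M₂ i + voteB I b M₁ M₂ i) =
        (if Even j then 1 - c else 0) := by
  have hc := h.two_lt
  induction j with
  | zero =>
    have hb := h.prefix_sum_bounds hj
    have h0 := h.voteA_zero
    simp only [zero_add, Finset.sum_range_one, Even.zero, if_true] at *
    rcases h.voteB_or hj with e | e
    · refine ⟨h0, e, ?_⟩
      linarith
    · linarith
  | succ n ih =>
    obtain ⟨-, -, hs⟩ := ih (by omega)
    obtain ⟨hl, hu⟩ := h.prefix_sum_bounds hj
    have hp := h.prefix_sum_le_one hj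
    rw [Finset.sum_range_succ, hs] at hl hu ⊢
    rw [hs] at hp
    by_cases he : Even n
    · have he' : ¬ Even (n + 1) := by simpa [Nat.even_add_one] using he
      simp only [he, he', if_true, if_false] at *
      rcases h.voteA_or hj with e | e <;> rcases h.voteB_or hj with e' | e' <;>
        rw [e, e'] at hl hu ⊢ <;> rw [e] at hp <;>
        first | (exfalso; linarith) | (refine ⟨rfl, rfl, ?_⟩; ring)
    · have he' : Even (n + 1) := by simpa [Nat.even_add_one] using he
      simp only [he, he', if_true, if_false] at *
      rcases h.voteA_or hj with e | e <;> rcases h.voteB_or hj with e' | e' <;>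
        rw [e, e'] at hl hu ⊢ <;> rw [e] at hp <;>
        first | (exfalso; linarith) | (refine ⟨rfl, rfl, ?_⟩; ring)

lemma even_length (h : IsPathComponent I c k a b M₁ M₂) : Even k := by
  obtain ⟨n, rfl⟩ : ∃ n, k = n + 1 := ⟨k - 1, by have := h.pos; omega⟩
  have h1 := (h.votes_and_sum n (by omega)).2.1
  rw [h.voteB_last rfl] at h1
  by_contra hk
  have he : Even n := by simpa [Nat.even_add_one] using hk
  rw [if_pos he] at h1
  norm_num at h1

lemma vote_M₁_diag (h : IsPathComponent I c k a b M₁ M₂) {i : ℕ} (hi : i < k) :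
    vote I M₁ (a i) (b i) + vote I M₁ (b i) (a i) = 0 := by
  simp [vote, h.M₁_a i hi, h.M₁_b hi]

lemma vote_M₂_step (h : IsPathComponent I c k a b M₁ M₂) {i : ℕ} (hi : i + 1 < k) :
    vote I M₂ (b i) (a (i + 1)) + vote I M₂ (a (i + 1)) (b i) = 0 := by
  simp [vote, h.M₂_a hi, h.M₂_b i hi]

lemma vote_M₁_step (h : IsPathComponent I c k a b M₁ M₂) {i : ℕ} (hi : i + 1 < k) :
    vote I M₁ (b i) (a (i + 1)) + vote I M₁ (a (i + 1)) (b i) =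
      if Even i then 1 + c else -1 - c := by
  have h1 : vote I M₁ (b i) (a (i + 1)) = voteB I b M₁ M₂ i := by
    rw [vote_eq_gain I M₁ (M₂.valid _ _ (h.M₂_b i hi)), voteB, h.M₂_b i hi]
  have h2 : vote I M₁ (a (i + 1)) (b i) = voteA I a M₁ M₂ (i + 1) := by
    rw [vote_eq_gain I M₁ (M₂.valid _ _ (h.M₂_a hi)), voteA, h.M₂_a hi]
  rw [h1, h2, (h.votes_and_sum i (by omega)).2.1, (h.votes_and_sum _ hi).1]
  by_cases he : Even i <;> simp [Nat.even_add_one, he]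
  ring

lemma vote_M₂_diag (h : IsPathComponent I c k a b M₁ M₂) {i : ℕ} (hi : i < k) :
    vote I M₂ (a i) (b i) + vote I M₂ (b i) (a i) = if Even i then c - 1 else 1 - c := by
  have h1 : vote I M₂ (a i) (b i) = - voteA I a M₁ M₂ i := by
    rw [vote_eq_gain I M₂ (M₁.valid _ _ (h.M₁_a i hi)), voteA, ← h.M₁_a i hi, gain_swap]
  have h2 : vote I M₂ (b i) (a i) = - voteB I b M₁ M₂ i := by
    rw [vote_eq_gain I M₂ (M₁.valid _ _ (h.M₁_b hi)), voteB, ← h.M₁_b hi, gain_swap]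
  rw [h1, h2, (h.votes_and_sum i hi).1, (h.votes_and_sum i hi).2.1]
  split_ifs <;> ring

lemma eq_zero_of_sum_eq_zero {f : ℕ → ℚ} {k : ℕ} (hf : ∀ i < k, 0 ≤ f i)
    (hs : ∑ i ∈ Finset.range k, f i = 0) {i : ℕ} (hi : i < k) : f i = 0 :=
  (Finset.sum_eq_zero_iff_of_nonneg fun j hj => hf j (by simpa using hj)).1 hs i (by simpa using hi)

lemma sum_alternating (r : ℚ) {k : ℕ} (hk : Even k) :
    ∑ i ∈ Finset.range k, (if Even i then r else -r) = 0 := by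
  obtain ⟨m, rfl⟩ := hk
  induction m with
  | zero => simp
  | succ m ih =>
    rw [show m + 1 + (m + 1) = m + m + 1 + 1 by ring, Finset.sum_range_succ,
      Finset.sum_range_succ, ih]
    simp [Nat.even_add_one]

/-- Uniqueness of the witness of the perfect matching. -/
lemma witness_M₁_eq (h : IsPathComponent I c k a b M₁ M₂) {y : V → ℚ} (hy : IsWitness I M₁ y)
    (hya : ∀ i < k, y (a i) ≤ 1) (hyb : ∀ i < k, y (b i) ≤ c) {i : ℕ} (hi : i < k) :
    y (a i) = (if Even i then -c else 1) ∧ y (b i) = (if Even i then c else -1) := by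
  obtain ⟨hsum, hedge, -, -⟩ := hy
  rw [h.sum_eq] at hsum
  have hdiag : ∀ i < k, y (a i) + y (b i) = 0 := by
    refine fun i hi => eq_zero_of_sum_eq_zero (fun i hi => ?_) hsum hi
    have := hedge _ _ (M₁.valid _ _ (h.M₁_a i hi))
    rwa [h.vote_M₁_diag hi] at this
  have hstep : ∀ i, i + 1 < k → Even i → y (b i) = c ∧ y (a (i + 1)) = 1 := by
    intro i hi he
    have := hedge _ _ (M₂.valid _ _ (h.M₂_b i hi))
    rw [h.vote_M₁_step hi, if_pos he] at this
    have := hya _ hi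
    have := hyb i (by omega)
    constructor <;> linarith
  have hd := hdiag i hi
  by_cases he : Even i
  · have hi' : i + 1 < k := by
      have := h.even_length
      grind
    have := (hstep i hi' he).1
    simp only [he, if_true]
    constructor <;> linarith
  · obtain _ | n := i
    · simp at he
    have hn : Even n := by simpa [Nat.even_add_one] using he
    have := (hstep n hi hn).2
    simp only [he, if_false]
    constructor <;> linarith

/-- Uniqueness of the witness of the matching missing the end vertices. -/
lemma witness_M₂_eq (h : IsPathComponent I c k a b M₁ M₂) {y : V → ℚ} (hy : IsWitness I M₂ y)
    {i : ℕ} (hi : i < k) :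
    y (a i) = (if Even i then 0 else 1 - c) ∧ y (b i) = (if Even i then c - 1 else 0) := by
  obtain ⟨hsum, hedge, hun, -⟩ := hy
  rw [h.sum_eq] at hsum
  have hdiag : ∀ i < k, y (a i) + y (b i) = if Even i then c - 1 else -(c - 1) := by
    intro i hi
    refine sub_eq_zero.mp (eq_zero_of_sum_eq_zero (k := k)
      (f := fun i => y (a i) + y (b i) - if Even i then c - 1 else -(c - 1)) (fun i hi => ?_) ?_ hi)
    · have := hedge _ _ (M₁.valid _ _ (h.M₁_a i hi))
      rw [h.vote_M₂_diag hi] at this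
      simpa using this
    · rw [Finset.sum_sub_distrib, hsum, sum_alternating _ h.even_length, sub_zero]
  obtain ⟨n, rfl⟩ : ∃ n, k = n + 1 := ⟨k - 1, by have := h.pos; omega⟩
  have hstep_nonneg : ∀ i < n, 0 ≤ y (b i) + y (a (i + 1)) := by
    intro i hi
    have := hedge _ _ (M₂.valid _ _ (h.M₂_b i (by omega)))
    rwa [h.vote_M₂_step (by omega)] at this
  have ha0 := hun _ h.M₂_a_zero
  have hbn := hun _ (h.M₂_b_last n rfl)
  have hsum' : (∑ i ∈ Finset.range n, (y (b i) + y (a (i + 1)))) + y (a 0) + y (b n) = 0 := by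
    rw [Finset.sum_add_distrib, Finset.sum_range_succ' (fun i => y (a i)),
      Finset.sum_range_succ (fun i => y (b i))] at hsum
    rw [Finset.sum_add_distrib]
    linarith
  have hsnn := Finset.sum_nonneg fun i hi => hstep_nonneg i (Finset.mem_range.1 hi)
  have hstep : ∀ i < n, y (b i) + y (a (i + 1)) = 0 := fun i hi =>
    eq_zero_of_sum_eq_zero (f := fun i => y (b i) + y (a (i + 1))) hstep_nonneg (by linarith) hi
  induction i with
  | zero =>
    have := hdiag 0 hi
    simp only [Even.zero, if_true] at *
    constructor <;> linarith
  | succ m ih =>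
    have h1 := (ih (by omega)).2
    have h2 := hdiag _ hi
    have h3 := hstep m (by omega)
    by_cases he : Even m
    · have he' : ¬ Even (m + 1) := by simpa [Nat.even_add_one] using he
      simp only [he, he', if_true, if_false] at *
      constructor <;> linarith
    · have he' : Even (m + 1) := by simpa [Nat.even_add_one] using he
      simp only [he, he', if_true, if_false] at *
      constructor <;> linarith

/-- The witness inequality on all edges follows from the one on consecutive path vertices. -/
lemma edge_bound {M : Matching V I.E} {y : V → ℚ}
    (hE : ∀ u v, I.E u v → ∃ i, (i < k ∧ ((u = a i ∧ v = b i) ∨ (u = b i ∧ v = a i))) ∨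
      (i + 1 < k ∧ ((u = b i ∧ v = a (i + 1)) ∨ (u = a (i + 1) ∧ v = b i))))
    (hdiag : ∀ i < k, vote I M (a i) (b i) + vote I M (b i) (a i) ≤ y (a i) + y (b i))
    (hstep : ∀ i, i + 1 < k → vote I M (b i) (a (i + 1)) + vote I M (a (i + 1)) (b i) ≤
      y (b i) + y (a (i + 1))) (u v : V) (huv : I.E u v) :
    vote I M u v + vote I M v u ≤ y u + y v := by
  obtain ⟨i, ⟨hi, ⟨rfl, rfl⟩ | ⟨rfl, rfl⟩⟩ | ⟨hi, ⟨rfl, rfl⟩ | ⟨rfl, rfl⟩⟩⟩ := hE u v huv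
  · exact hdiag i hi
  · linarith [hdiag i hi]
  · exact hstep i hi
  · linarith [hstep i hi]

/-- The function on the vertices with prescribed values along the path. -/
lemma exists_values (h : IsPathComponent I c k a b M₁ M₂) (f g : ℕ → ℚ) :
    ∃ y : V → ℚ, ∀ i < k, y (a i) = f i ∧ y (b i) = g i := by
  classical
  refine ⟨fun v => if hv : ∃ i < k, v = a i then f hv.choose else
    if hv : ∃ i < k, v = b i then g hv.choose else 0, fun i hi => ⟨?_, ?_⟩⟩
  · have hv : ∃ j < k, a i = a j := ⟨i, hi, rfl⟩
    simp only [dif_pos hv]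
    rw [← h.a_inj i hi _ hv.choose_spec.1 hv.choose_spec.2]
  · have hv' : ¬ ∃ j < k, b i = a j := fun ⟨j, hj, e⟩ => h.a_ne_b j hj i hi e.symm
    have hv : ∃ j < k, b i = b j := ⟨i, hi, rfl⟩
    simp only [dif_neg hv', dif_pos hv]
    rw [← h.b_inj i hi _ hv.choose_spec.1 hv.choose_spec.2]

end IsPathComponent

/-- On a path component `⟨a₁, b₁, a₂, b₂, …, a_k, b_k⟩`, the perfect popular
matching `M₁` and the popular matching `M₂` leaving `a₁` (and `b_k`) unmatched
have unique nice witnesses, with the prescribed alternating values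
(indices below are 0-based, so `a i` is `a_{i+1}` of the path). -/
theorem path_component_unique_nice_witnesses (I : PMInstance V) (c : ℚ) (hc : 3 < c)
    (hA : ∀ a ∈ I.A, I.w a = c) (hB : ∀ b : V, b ∉ I.A → I.w b = 1)
    (k : ℕ) (hk : 0 < k) (a b : Fin k → V)
    (ha : ∀ i, a i ∈ I.A) (hb : ∀ i, b i ∉ I.A)
    (hinj : Function.Injective (fun x : Fin k ⊕ Fin k => Sum.elim a b x))
    (hcover : ∀ v : V, (∃ i, v = a i) ∨ (∃ i, v = b i))
    (hE : ∀ u v : V, I.E u v ↔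
      ((∃ i : Fin k, (u = a i ∧ v = b i) ∨ (u = b i ∧ v = a i)) ∨
        (∃ i j : Fin k, (j : ℕ) = (i : ℕ) + 1 ∧
          ((u = b i ∧ v = a j) ∨ (u = a j ∧ v = b i)))))
    (M₁ M₂ : Matching V I.E)
    (hM₁ : ∀ i, M₁.m (a i) = some (b i))
    (hM₂edge : ∀ i j : Fin k, (j : ℕ) = (i : ℕ) + 1 → M₂.m (b i) = some (a j))
    (hM₂a : M₂.m (a ⟨0, hk⟩) = none)
    (hM₂b : M₂.m (b ⟨k - 1, Nat.sub_lt hk one_pos⟩) = none)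
    (hpop₁ : popular I M₁) (hpop₂ : popular I M₂) :
    ((∃ y, NiceWitness I M₁ c y) ∧
      ∀ y, NiceWitness I M₁ c y →
        ∀ i : Fin k, (y (a i) = if Even (i : ℕ) then -c else 1) ∧
          (y (b i) = if Even (i : ℕ) then c else -1)) ∧
    ((∃ y, NiceWitness I M₂ c y) ∧
      ∀ y, NiceWitness I M₂ c y →
        ∀ i : Fin k, (y (a i) = if Even (i : ℕ) then 0 else 1 - c) ∧
          (y (b i) = if Even (i : ℕ) then c - 1 else 0)) := by
  classical
  set a' : ℕ → V := fun n => if h : n < k then a ⟨n, h⟩ else a ⟨0, hk⟩ with ha'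
  set b' : ℕ → V := fun n => if h : n < k then b ⟨n, h⟩ else b ⟨0, hk⟩ with hb'
  have ea : ∀ n (h : n < k), a' n = a ⟨n, h⟩ := fun n h => dif_pos h
  have eb : ∀ n (h : n < k), b' n = b ⟨n, h⟩ := fun n h => dif_pos h
  have hcover' : ∀ v, (∃ i < k, v = a' i) ∨ (∃ i < k, v = b' i) := by
    intro v
    rcases hcover v with ⟨i, e⟩ | ⟨i, e⟩
    · exact .inl ⟨i, i.2, by rw [ea i i.2, e]⟩
    · exact .inr ⟨i, i.2, by rw [eb i i.2, e]⟩
  have haA : ∀ i < k, a' i ∈ I.A := fun i hi => ea i hi ▸ ha _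
  have hbA : ∀ i < k, b' i ∉ I.A := fun i hi => eb i hi ▸ hb _
  have hP : IsPathComponent I c k a' b' M₁ M₂ :=
    { pos := hk
      two_lt := by linarith
      w_a := fun i hi => hA _ (haA i hi)
      w_b := fun i hi => hB _ (hbA i hi)
      a_inj := fun i hi j hj e => by
        rw [ea i hi, ea j hj] at e
        simpa using @hinj (.inl ⟨i, hi⟩) (.inl ⟨j, hj⟩) e
      b_inj := fun i hi j hj e => by
        rw [eb i hi, eb j hj] at e
        simpa using @hinj (.inr ⟨i, hi⟩) (.inr ⟨j, hj⟩) e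
      a_ne_b := fun i hi j hj e => hbA j hj (e ▸ haA i hi)
      sum_eq := fun F => by
        have hbij : Function.Bijective (fun x : Fin k ⊕ Fin k => Sum.elim a b x) := by
          refine ⟨hinj, fun v => ?_⟩
          rcases hcover v with ⟨i, e⟩ | ⟨i, e⟩
          · exact ⟨.inl i, e.symm⟩
          · exact ⟨.inr i, e.symm⟩
        rw [← Fin.sum_univ_eq_sum_range (fun i => F (a' i) + F (b' i)),
          ← hbij.sum_comp F, Fintype.sum_sum_type, ← Finset.sum_add_distrib]
        refine Finset.sum_congr rfl fun i _ => ?_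
        rw [ea i i.2, eb i i.2]
        rfl
      M₁_a := fun i hi => by
        rw [ea i hi, eb i hi]
        exact hM₁ _
      M₂_b := fun i hi => by
        rw [ea _ hi, eb i (by omega)]
        exact hM₂edge _ _ rfl
      M₂_a_zero := by rw [ea 0 hk, hM₂a]
      M₂_b_last := fun i hi => by
        obtain rfl : i = k - 1 := by omega
        rw [eb _ (by omega), hM₂b]
      popular₁ := hpop₁
      popular₂ := hpop₂ }
  have hE' : ∀ u v, I.E u v →
      ∃ i, (i < k ∧ ((u = a' i ∧ v = b' i) ∨ (u = b' i ∧ v = a' i))) ∨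
      (i + 1 < k ∧ ((u = b' i ∧ v = a' (i + 1)) ∨ (u = a' (i + 1) ∧ v = b' i))) := by
    intro u v huv
    rcases (hE u v).1 huv with ⟨i, hi⟩ | ⟨i, j, hij, hi⟩
    · refine ⟨i, .inl ⟨i.2, ?_⟩⟩
      rwa [ea i i.2, eb i i.2]
    · have hj : (i : ℕ) + 1 < k := hij ▸ j.2
      refine ⟨i, .inr ⟨hj, ?_⟩⟩
      obtain rfl : j = ⟨i + 1, hj⟩ := Fin.ext hij
      rwa [ea _ hj, eb i i.2]
  refine ⟨⟨?_, fun y hy i => ?_⟩, ⟨?_, fun y hy i => ?_⟩⟩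
  · obtain ⟨y, hy⟩ := hP.exists_values (fun i => if Even i then -c else 1)
      (fun i => if Even i then c else -1)
    refine ⟨y, ⟨?_, IsPathComponent.edge_bound hE' ?_ ?_, ?_, ?_⟩, ?_, ?_⟩
    · rw [hP.sum_eq]
      refine Finset.sum_eq_zero fun i hi => ?_
      rw [(hy i (by simpa using hi)).1, (hy i (by simpa using hi)).2]
      split_ifs <;> ring
    · intro i hi
      rw [hP.vote_M₁_diag hi, (hy i hi).1, (hy i hi).2]
      split_ifs <;> linarith
    · intro i hi
      rw [hP.vote_M₁_step hi, (hy _ hi).1, (hy i (by omega)).2]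
      by_cases he : Even i <;> simp only [he, Nat.even_add_one, if_true, if_false, not_true,
        not_false_iff] <;> linarith
    · intro v hv
      rcases hcover' v with ⟨i, hi, rfl⟩ | ⟨i, hi, rfl⟩
      · simp [hP.M₁_a i hi] at hv
      · simp [hP.M₁_b hi] at hv
    · intro v
      rcases hcover' v with ⟨i, hi, rfl⟩ | ⟨i, hi, rfl⟩
      · rw [hP.w_a i hi, (hy i hi).1]
        split_ifs <;> linarith
      · rw [hP.w_b i hi, (hy i hi).2]
        split_ifs <;> linarith
    · intro v hv
      rcases hcover' v with ⟨i, hi, rfl⟩ | ⟨i, hi, rfl⟩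
      · rw [(hy i hi).1]
        split_ifs <;> simp
      · exact absurd hv (hbA i hi)
    · intro v hv
      rcases hcover' v with ⟨i, hi, rfl⟩ | ⟨i, hi, rfl⟩
      · exact absurd (haA i hi) hv
      · rw [(hy i hi).2]
        split_ifs <;> simp
  · have := hP.witness_M₁_eq hy.1 (fun i hi => ?_) (fun i hi => ?_) i.2
    · rwa [ea i i.2, eb i i.2] at this
    · rcases hy.2.1 _ (haA i hi) with h | h | h | h | h | h <;> rw [h] <;> linarith
    · rcases hy.2.2 _ (hbA i hi) with h | h | h | h | h | h <;> rw [h] <;> linarith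
  · obtain ⟨y, hy⟩ := hP.exists_values (fun i => if Even i then 0 else 1 - c)
      (fun i => if Even i then c - 1 else 0)
    refine ⟨y, ⟨?_, IsPathComponent.edge_bound hE' ?_ ?_, ?_, ?_⟩, ?_, ?_⟩
    · rw [hP.sum_eq, ← IsPathComponent.sum_alternating (c - 1) hP.even_length]
      refine Finset.sum_congr rfl fun i hi => ?_
      rw [(hy i (by simpa using hi)).1, (hy i (by simpa using hi)).2]
      split_ifs <;> ring
    · intro i hi
      rw [hP.vote_M₂_diag hi, (hy i hi).1, (hy i hi).2]
      split_ifs <;> linarith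
    · intro i hi
      rw [hP.vote_M₂_step hi, (hy _ hi).1, (hy i (by omega)).2]
      by_cases he : Even i <;> simp only [he, Nat.even_add_one, if_true, if_false, not_true,
        not_false_iff] <;> linarith
    · intro v hv
      rcases hcover' v with ⟨i, hi, rfl⟩ | ⟨i, hi, rfl⟩
      · obtain _ | i := i
        · simp [(hy 0 hi).1]
        · simp [hP.M₂_a hi] at hv
      · rw [(hy i hi).2]
        split_ifs <;> linarith
    · intro v
      rcases hcover' v with ⟨i, hi, rfl⟩ | ⟨i, hi, rfl⟩
      · rw [hP.w_a i hi, (hy i hi).1]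
        split_ifs <;> linarith
      · rw [hP.w_b i hi, (hy i hi).2]
        split_ifs <;> linarith
    · intro v hv
      rcases hcover' v with ⟨i, hi, rfl⟩ | ⟨i, hi, rfl⟩
      · rw [(hy i hi).1]
        split_ifs <;> simp
      · exact absurd hv (hbA i hi)
    · intro v hv
      rcases hcover' v with ⟨i, hi, rfl⟩ | ⟨i, hi, rfl⟩
      · exact absurd (haA i hi) hv
      · rw [(hy i hi).2]
        split_ifs <;> simp
  · have := hP.witness_M₂_eq hy.1 i.2
    rwa [ea i i.2, eb i i.2] at this
end
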